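/- Let V be a finite-dimensional representation of sl(2,C) with generators e, h, f, and let σ : V → V be a linear involution such that σ∘e = −e∘σ, σ∘h = h∘σ, σ∘f = −f∘σ (where e, h, f denote the action operators). Then for every even weight 2j, the weight space V_{2j} satisfies σ(V_{2j}) = V_{2j} and dim(V_{2j} ∩ ker(σ−1)) − dim(V_{2j} ∩ ker(σ+1)) = dim(V_{−2j} ∩ ker(σ−1)) − dim(V_{−2j} ∩ ker(σ+1)); moreover, if W ⊆ V is an irreducible summand of odd highest weight preserved by σ, then dim(W ∩ ker(σ−1)) = dim(W ∩ ker(σ+1)). -/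

import Mathlib

namespace Stmt15Aux

open Module

variable {V : Type*} [AddCommGroup V] [Module ℂ V] [FiniteDimensional ℂ V]

lemma exists_eig (T : End ℂ V) (K : Submodule ℂ V) (hK : K ≠ ⊥) (hT : ∀ x ∈ K, T x ∈ K) :
    ∃ c : ℂ, ∃ v ∈ K, v ≠ 0 ∧ T v = c • v := by
  haveI : Nontrivial K := Submodule.nontrivial_iff_ne_bot.mpr hK
  obtain ⟨c, hc⟩ := Module.End.exists_eigenvalue (T.restrict hT)
  obtain ⟨v, hv⟩ := hc.exists_hasEigenvector
  refine ⟨c, v.1, v.2, fun h => hv.2 (Subtype.ext h), ?_⟩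
  have := congrArg Subtype.val hv.apply_eq_smul
  simpa using this

lemma nilp (E H : End ℂ V) (hHE : ∀ x, H (E x) = E (H x) + (2 : ℂ) • E x) :
    ∃ k : ℕ, E ^ k = 0 := by
  by_contra! contra
  have key : ∀ k : ℕ, ∀ x, H ((E ^ k) x) = (E ^ k) (H x) + (2 * k : ℂ) • (E ^ k) x := by
    intro k
    induction k with
    | zero => simp
    | succ k ih =>
      intro x
      rw [pow_succ', Module.End.mul_apply, Module.End.mul_apply, hHE, ih, map_add, map_smul]
      push_cast
      module
  let T : End ℂ (End ℂ V) := LinearMap.mulLeft ℂ H - LinearMap.mulRight ℂ H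
  have hli := Module.End.eigenvectors_linearIndependent' T (fun k : ℕ => (2 * k : ℂ))
    (fun a b hab => by simpa using hab) (fun k => E ^ k) (fun k => by
      refine ⟨?_, contra k⟩
      rw [Module.End.mem_eigenspace_iff]
      ext x
      simp [T, key])
  have hfin : Finite ℕ := hli.finite
  exact not_finite ℕ

lemma raise (E H : End ℂ V) (hHE : ∀ x, H (E x) = E (H x) + (2 : ℂ) • E x)
    (a : ℂ) (v : V) (hv : H v = a • v) (k : ℕ) :
    H ((E ^ k) v) = (a + 2 * k) • (E ^ k) v := by
  induction k with
  | zero => simpa using hv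
  | succ k ih =>
    rw [pow_succ', Module.End.mul_apply, hHE, ih, map_smul]
    push_cast
    module

lemma core (E H F : End ℂ V) (hHE : ∀ x, H (E x) = E (H x) + (2 : ℂ) • E x)
    (hEF : ∀ x, E (F x) = F (E x) + H x)
    (c a : ℂ) (v : V) (hv0 : v ≠ 0) (hv : H v = a • v)
    (hc : (4 : ℂ) • F (E v) + H (H v) + (2 : ℂ) • H v = c • v) (n : ℕ) (hn : (E ^ n) v = 0) :
    ∃ k < n, c = (a + 2 * k) * (a + 2 * k + 2) := by
  obtain ⟨k, hk, hk1⟩ := Nat.exists_not_and_succ_of_not_zero_of_exists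
    (p := fun k => (E ^ k) v = 0) (by simpa using hv0) ⟨n, hn⟩
  have hC : ∀ j : ℕ, (4 : ℂ) • F (E ((E ^ j) v)) + H (H ((E ^ j) v)) + (2 : ℂ) • H ((E ^ j) v)
      = c • (E ^ j) v := by
    intro j
    induction j with
    | zero => simpa using hc
    | succ j ih =>
      rw [pow_succ', Module.End.mul_apply]
      have := congrArg E ih
      simp only [map_add, map_smul, hHE, hEF] at this ⊢
      rw [← this]
      module
  refine ⟨k, ?_, ?_⟩
  · by_contra! h
    obtain ⟨r, rfl⟩ := Nat.exists_eq_add_of_le h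
    apply hk
    rw [add_comm, pow_add, Module.End.mul_apply, hn, map_zero]
  · have h1 := hC k
    have h2 : E ((E ^ k) v) = 0 := by
      rw [← Module.End.mul_apply, ← pow_succ']; exact hk1
    rw [h2, raise E H hHE a v hv k, map_smul, raise E H hHE a v hv k] at h1
    have h3 : (c - (a + 2 * k) * (a + 2 * k + 2)) • (E ^ k) v = 0 := by
      rw [sub_smul, ← h1]
      simp only [map_zero]
      module
    rcases smul_eq_zero.mp h3 with h | h
    · exact sub_eq_zero.mp h
    · exact absurd h hk

lemma injE (E H F : End ℂ V) (hHE : ∀ x, H (E x) = E (H x) + (2 : ℂ) • E x)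
    (hHF : ∀ x, H (F x) = F (H x) - (2 : ℂ) • F x)
    (hEF : ∀ x, E (F x) = F (E x) + H x) (n : ℕ) (x : V) (hx : H x = (-n : ℂ) • x)
    (hEx : (E ^ n) x = 0) : x = 0 := by
  by_contra hx0
  let C : End ℂ V := (4 : ℂ) • (F * E) + H * H + (2 : ℂ) • H
  have hCH : ∀ y, H (C y) = C (H y) := by
    intro y
    simp only [C, LinearMap.add_apply, LinearMap.smul_apply, Module.End.mul_apply, map_add,
      map_smul, hHE, hHF, map_sub]
    module
  have hCE : ∀ y, E (C y) = C (E y) := by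
    intro y
    simp only [C, LinearMap.add_apply, LinearMap.smul_apply, Module.End.mul_apply, map_add,
      map_smul, hHE, hHF, hEF, map_sub]
    module
  have hCEn : ∀ k : ℕ, ∀ y, (E ^ k) (C y) = C ((E ^ k) y) := by
    intro k
    induction k with
    | zero => simp
    | succ k ih => intro y; rw [pow_succ', Module.End.mul_apply, ih, hCE, Module.End.mul_apply]
  let K : Submodule ℂ V := End.eigenspace H (-n : ℂ) ⊓ LinearMap.ker (E ^ n)
  have hxK : x ∈ K := ⟨Module.End.mem_eigenspace_iff.mpr hx, hEx⟩
  obtain ⟨c, v, hvK, hv0, hcv⟩ := exists_eig C K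
    (fun h => hx0 (by rw [h] at hxK; simpa using hxK)) (by
      rintro y ⟨h1, h2⟩
      have h1' := Module.End.mem_eigenspace_iff.mp h1
      refine ⟨Module.End.mem_eigenspace_iff.mpr ?_, ?_⟩
      · rw [hCH, h1', map_smul]
      · have h2' : (E ^ n) y = 0 := h2
        change (E ^ n) (C y) = 0
        rw [hCEn, h2', map_zero])
  have hv1 := Module.End.mem_eigenspace_iff.mp hvK.1
  have hv2 : (E ^ n) v = 0 := hvK.2
  have hcv' : (4 : ℂ) • F (E v) + H (H v) + (2 : ℂ) • H v = c • v := by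
    rw [← hcv]; simp [C]
  obtain ⟨k, hk, hck⟩ := core E H F hHE hEF c (-n) v hv0 hv1 hcv' n hv2
  obtain ⟨N, hN⟩ := nilp F (-H) (by intro y; simp only [LinearMap.neg_apply, map_neg, hHF]; module)
  obtain ⟨l, hl, hcl⟩ := core F (-H) E
    (by intro y; simp only [LinearMap.neg_apply, map_neg, hHF]; module)
    (by intro y; simp only [LinearMap.neg_apply, hEF]; module) c n v hv0
    (by simp [hv1]) (by
      rw [← hcv']; simp only [LinearMap.neg_apply, map_neg, hEF]; module) N (by simp [hN])
  rw [hck] at hcl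
  have hz : ((-n + 2 * k) * (-n + 2 * k + 2) : ℤ) = (n + 2 * l) * (n + 2 * l + 2) := by
    exact_mod_cast hcl
  have h0 : ((n : ℤ) + l - k) * (l + k + 1) = 0 := by linarith
  have : (k : ℤ) < n := by exact_mod_cast hk
  rcases mul_eq_zero.mp h0 with h | h <;> omega

lemma le_of_inj (A B : Submodule ℂ V) (T : End ℂ V) (hT : ∀ x ∈ A, T x ∈ B)
    (hi : ∀ x ∈ A, T x = 0 → x = 0) : finrank ℂ A ≤ finrank ℂ B := by
  apply LinearMap.finrank_le_finrank_of_injective (f := T.restrict hT)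
  rw [← LinearMap.ker_eq_bot, LinearMap.ker_eq_bot']
  intro x hx
  apply Subtype.ext
  exact hi x.1 x.2 (by simpa using congrArg Subtype.val hx)

lemma pow_even (E σ : End ℂ V) (hσE : ∀ x, σ (E x) = -(E (σ x))) (n : ℕ) (x : V) :
    σ ((E ^ (2 * n)) x) = (E ^ (2 * n)) (σ x) := by
  induction n with
  | zero => simp
  | succ n ih =>
    rw [show 2 * (n + 1) = 2 * n + 1 + 1 by ring, pow_succ', pow_succ']
    simp only [Module.End.mul_apply, hσE, ih, map_neg, neg_neg]

lemma le_half (E H F σ : End ℂ V) (hHE : ∀ x, H (E x) = E (H x) + (2 : ℂ) • E x)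
    (hHF : ∀ x, H (F x) = F (H x) - (2 : ℂ) • F x)
    (hEF : ∀ x, E (F x) = F (E x) + H x)
    (hσE : ∀ x, σ (E x) = -(E (σ x))) (n : ℕ) (s : ℂ) :
    finrank ℂ ↥(End.eigenspace H (-(2 * n : ℕ) : ℂ) ⊓ LinearMap.ker (σ - s • 1)) ≤
    finrank ℂ ↥(End.eigenspace H ((2 * n : ℕ) : ℂ) ⊓ LinearMap.ker (σ - s • 1)) := by
  apply le_of_inj _ _ (E ^ (2 * n))
  · rintro x ⟨h1, h2⟩
    have h1' := Module.End.mem_eigenspace_iff.mp h1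
    refine ⟨Module.End.mem_eigenspace_iff.mpr ?_, ?_⟩
    · rw [raise E H hHE _ x h1']
      push_cast
      module
    · have h2' : σ x = s • x := by
        simpa [sub_eq_zero] using h2
      simp [sub_eq_zero, pow_even E σ hσE, h2']
  · rintro x ⟨h1, h2⟩ h
    exact injE E H F hHE hHF hEF (2 * n) x (Module.End.mem_eigenspace_iff.mp h1) h

lemma eq_half (E H F σ : End ℂ V) (hHE : ∀ x, H (E x) = E (H x) + (2 : ℂ) • E x)
    (hHF : ∀ x, H (F x) = F (H x) - (2 : ℂ) • F x)
    (hEF : ∀ x, E (F x) = F (E x) + H x)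
    (hσE : ∀ x, σ (E x) = -(E (σ x))) (hσF : ∀ x, σ (F x) = -(F (σ x))) (n : ℕ) (s : ℂ) :
    finrank ℂ ↥(End.eigenspace H (-(2 * n : ℕ) : ℂ) ⊓ LinearMap.ker (σ - s • 1)) =
    finrank ℂ ↥(End.eigenspace H ((2 * n : ℕ) : ℂ) ⊓ LinearMap.ker (σ - s • 1)) := by
  apply le_antisymm (le_half E H F σ hHE hHF hEF hσE n s)
  have h := le_half F (-H) E σ
    (by intro y; simp only [LinearMap.neg_apply, map_neg, hHF]; module)
    (by intro y; simp only [LinearMap.neg_apply, map_neg, hHE]; module)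
    (by intro y; simp only [LinearMap.neg_apply, hEF]; module) hσF n s
  have hneg : ∀ a : ℂ, End.eigenspace (-H) a = End.eigenspace H (-a) := by
    intro a
    ext x
    rw [Module.End.mem_eigenspace_iff, Module.End.mem_eigenspace_iff, LinearMap.neg_apply,
      neg_smul, neg_eq_iff_eq_neg]
  rwa [hneg, hneg, neg_neg] at h

lemma eq_all (E H F σ : End ℂ V) (hHE : ∀ x, H (E x) = E (H x) + (2 : ℂ) • E x)
    (hHF : ∀ x, H (F x) = F (H x) - (2 : ℂ) • F x)
    (hEF : ∀ x, E (F x) = F (E x) + H x)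
    (hσE : ∀ x, σ (E x) = -(E (σ x))) (hσF : ∀ x, σ (F x) = -(F (σ x))) (j : ℤ) (s : ℂ) :
    finrank ℂ ↥(End.eigenspace H ((2 * j : ℤ) : ℂ) ⊓ LinearMap.ker (σ - s • 1)) =
    finrank ℂ ↥(End.eigenspace H ((-(2 * j) : ℤ) : ℂ) ⊓ LinearMap.ker (σ - s • 1)) := by
  obtain ⟨n, rfl | rfl⟩ := j.eq_nat_or_neg
  · have := eq_half E H F σ hHE hHF hEF hσE hσF n s
    rw [show ((2 * (n : ℤ) : ℤ) : ℂ) = ((2 * n : ℕ) : ℂ) by push_cast; rfl,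
      show ((-(2 * (n : ℤ)) : ℤ) : ℂ) = -((2 * n : ℕ) : ℂ) by push_cast; rfl]
    exact this.symm
  · have := eq_half E H F σ hHE hHF hEF hσE hσF n s
    rw [show ((2 * (-(n : ℤ)) : ℤ) : ℂ) = -((2 * n : ℕ) : ℂ) by push_cast; ring,
      show ((-(2 * (-(n : ℤ))) : ℤ) : ℂ) = ((2 * n : ℕ) : ℂ) by push_cast; ring]
    exact this

/-- On an irreducible submodule of even dimension, `H` is injective. -/
lemma injH (E H F : End ℂ V) (hHE : ∀ x, H (E x) = E (H x) + (2 : ℂ) • E x)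
    (hHF : ∀ x, H (F x) = F (H x) - (2 : ℂ) • F x)
    (hEF : ∀ x, E (F x) = F (E x) + H x) (d : ℕ) (hd : Odd d) (W : Submodule ℂ V)
    (hW : ∀ x ∈ W, E x ∈ W ∧ H x ∈ W ∧ F x ∈ W)
    (hirr : ∀ U : Submodule ℂ V, U ≤ W →
        (∀ x ∈ U, E x ∈ U ∧ H x ∈ U ∧ F x ∈ U) → U = ⊥ ∨ U = W)
    (hdim : finrank ℂ W = d + 1) (x : V) (hx : x ∈ W) (hHx : H x = 0) : x = 0 := by
  have hWne : W ≠ ⊥ := by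
    rintro rfl
    simp at hdim
  -- a primitive vector
  obtain ⟨a, w, hwW, hw0, hHw⟩ := exists_eig H W hWne (fun y hy => (hW y hy).2.1)
  obtain ⟨N, hN⟩ := nilp E H hHE
  obtain ⟨k, hk, hk1⟩ := Nat.exists_not_and_succ_of_not_zero_of_exists
    (p := fun k => (E ^ k) w = 0) (by simpa using hw0) ⟨N, by simp [hN]⟩
  have hEW : ∀ j : ℕ, (E ^ j) w ∈ W := by
    intro j
    induction j with
    | zero => simpa using hwW
    | succ j ih => rw [pow_succ', Module.End.mul_apply]; exact (hW _ ih).1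
  obtain ⟨m, hm⟩ : ∃ m, m = (E ^ k) w := ⟨_, rfl⟩
  obtain ⟨μ, hμ⟩ : ∃ μ : ℂ, μ = a + 2 * k := ⟨_, rfl⟩
  have hHm : H m = μ • m := by rw [hm, hμ]; exact raise E H hHE a w hHw k
  have hEm : E m = 0 := by rw [hm, ← Module.End.mul_apply, ← pow_succ']; exact hk1
  have hmW : m ∈ W := hm ▸ hEW k
  have hm0 : m ≠ 0 := hm ▸ hk
  have hFW : ∀ j : ℕ, (F ^ j) m ∈ W := by
    intro j
    induction j with
    | zero => simpa using hmW
    | succ j ih => rw [pow_succ', Module.End.mul_apply]; exact (hW _ ih).2.2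
  have hHv : ∀ j : ℕ, H ((F ^ j) m) = (μ - 2 * j) • (F ^ j) m := by
    intro j
    induction j with
    | zero => simpa using hHm
    | succ j ih =>
      rw [pow_succ', Module.End.mul_apply, hHF, ih, map_smul]
      push_cast
      module
  have hEv : ∀ j : ℕ, E ((F ^ (j + 1)) m) = ((j + 1) * (μ - j)) • (F ^ j) m := by
    intro j
    induction j with
    | zero => simp [hEF, hEm, hHm]
    | succ j ih =>
      rw [pow_succ', Module.End.mul_apply, hEF, ih, hHv, map_smul, ← Module.End.mul_apply,
        ← pow_succ']
      push_cast
      module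
  obtain ⟨M, hM⟩ := nilp F (-H)
    (by intro y; simp only [LinearMap.neg_apply, map_neg, hHF]; module)
  obtain ⟨n, hn, hn1⟩ := Nat.exists_not_and_succ_of_not_zero_of_exists
    (p := fun k => (F ^ k) m = 0) (by simpa using hm0) ⟨M, by simp [hM]⟩
  have hne : ∀ i ≤ n, (F ^ i) m ≠ 0 := by
    intro i hi h
    obtain ⟨r, rfl⟩ := Nat.exists_eq_add_of_le hi
    apply hn
    rw [add_comm, pow_add, Module.End.mul_apply, h, map_zero]
  have hμn : μ = n := by
    have h := hEv n
    rw [hn1, map_zero, eq_comm, smul_eq_zero] at h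
    rcases h with h | h
    · rcases mul_eq_zero.mp h with h | h
      · exact absurd h (Nat.cast_add_one_ne_zero n)
      · exact sub_eq_zero.mp h
    · exact absurd h hn
  let v : Fin (n + 1) → V := fun i => (F ^ (i : ℕ)) m
  have hli : LinearIndependent ℂ v :=
    Module.End.eigenvectors_linearIndependent' H (fun i : Fin (n + 1) => (μ - 2 * (i : ℕ) : ℂ))
      (fun i j hij => by
        have : (i : ℕ) = (j : ℕ) := by simpa using hij
        exact Fin.ext this) v
      (fun i => ⟨Module.End.mem_eigenspace_iff.mpr (hHv i), hne i (by omega)⟩)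
  have hmem : ∀ j : ℕ, (F ^ j) m ∈ Submodule.span ℂ (Set.range v) := by
    intro j
    by_cases hj : j < n + 1
    · exact Submodule.subset_span ⟨⟨j, hj⟩, rfl⟩
    · obtain ⟨r, rfl⟩ := Nat.exists_eq_add_of_le (not_lt.mp hj)
      have hz : (F ^ (n + 1 + r)) m = 0 := by
        rw [add_comm, pow_add, Module.End.mul_apply, hn1, map_zero]
      rw [hz]
      exact zero_mem _
  have hstab : ∀ T : End ℂ V, (∀ j : ℕ, T ((F ^ j) m) ∈ Submodule.span ℂ (Set.range v)) →
      ∀ y ∈ Submodule.span ℂ (Set.range v), T y ∈ Submodule.span ℂ (Set.range v) := by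
    intro T hT y hy
    have : Submodule.span ℂ (Set.range v) ≤ (Submodule.span ℂ (Set.range v)).comap T := by
      rw [Submodule.span_le]
      rintro _ ⟨i, rfl⟩
      exact hT i
    exact this hy
  have hU := hirr (Submodule.span ℂ (Set.range v))
    (by rw [Submodule.span_le]; rintro _ ⟨i, rfl⟩; exact hFW i)
    (fun y hy => ⟨hstab E (fun j => by
        cases j with
        | zero => simp [hEm]
        | succ j => rw [hEv]; exact Submodule.smul_mem _ _ (hmem j)) y hy,
      hstab H (fun j => by rw [hHv]; exact Submodule.smul_mem _ _ (hmem j)) y hy,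
      hstab F (fun j => by
        rw [← Module.End.mul_apply, ← pow_succ']; exact hmem (j + 1)) y hy⟩)
  have hUW : Submodule.span ℂ (Set.range v) = W := by
    refine hU.resolve_left (fun h => hm0 ?_)
    have := hmem 0
    rw [h] at this
    simpa using this
  have hnd : n = d := by
    have h := finrank_span_eq_card hli
    rw [hUW, hdim, Fintype.card_fin] at h
    omega
  rw [← hUW] at hx
  obtain ⟨c, rfl⟩ := (Submodule.mem_span_range_iff_exists_fun ℂ).mp hx
  have h0 : ∑ i, (c i * (μ - 2 * (i : ℕ))) • v i = 0 := by
    rw [← hHx, map_sum]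
    refine Finset.sum_congr rfl (fun i _ => ?_)
    rw [map_smul, show H (v i) = _ from hHv i, smul_smul]
  have hc := Fintype.linearIndependent_iff.mp hli _ h0
  refine Finset.sum_eq_zero (fun i _ => ?_)
  rcases mul_eq_zero.mp (hc i) with h | h
  · rw [h, zero_smul]
  · exfalso
    rw [hμn, sub_eq_zero] at h
    have h' : n = 2 * (i : ℕ) := by exact_mod_cast h
    obtain ⟨r, hr⟩ := hd
    omega

end Stmt15Aux


/-- For an `sl₂(ℂ)`-module with a linear involution `σ` anticommuting with `e, f`
and commuting with `h`: `σ` preserves each even weight space, the signed eigenspace-dimension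
count of `σ` on the weight space of weight `2j` agrees with that on weight `-2j`, and on any
`σ`-stable irreducible summand of odd highest weight the `+1` and `-1` eigenspaces of `σ` have
equal dimension. -/
theorem stmt_15 {V : Type*} [AddCommGroup V] [Module ℂ V] [FiniteDimensional ℂ V]
    (E H F σ : Module.End ℂ V)
    (hHE : ⁅H, E⁆ = (2 : ℂ) • E) (hHF : ⁅H, F⁆ = (-2 : ℂ) • F) (hEF : ⁅E, F⁆ = H)
    (hσ2 : σ * σ = 1)
    (hσE : σ * E = -(E * σ)) (hσH : σ * H = H * σ) (hσF : σ * F = -(F * σ)) :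
    (∀ j : ℤ,
      Submodule.map (σ : V →ₗ[ℂ] V) (Module.End.eigenspace H ((2 * j : ℤ) : ℂ)) =
        Module.End.eigenspace H ((2 * j : ℤ) : ℂ)) ∧
    (∀ j : ℤ,
      (Module.finrank ℂ
            ↥(Module.End.eigenspace H ((2 * j : ℤ) : ℂ) ⊓ LinearMap.ker (σ - 1)) : ℤ) -
          (Module.finrank ℂ
            ↥(Module.End.eigenspace H ((2 * j : ℤ) : ℂ) ⊓ LinearMap.ker (σ + 1)) : ℤ) =
        (Module.finrank ℂ
            ↥(Module.End.eigenspace H ((-(2 * j) : ℤ) : ℂ) ⊓ LinearMap.ker (σ - 1)) : ℤ) -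
          (Module.finrank ℂ
            ↥(Module.End.eigenspace H ((-(2 * j) : ℤ) : ℂ) ⊓ LinearMap.ker (σ + 1)) : ℤ)) ∧
    (∀ d : ℕ, Odd d → ∀ W : Submodule ℂ V,
      (∀ x ∈ W, E x ∈ W ∧ H x ∈ W ∧ F x ∈ W ∧ σ x ∈ W) →
      (∀ U : Submodule ℂ V, U ≤ W →
        (∀ x ∈ U, E x ∈ U ∧ H x ∈ U ∧ F x ∈ U) → U = ⊥ ∨ U = W) →
      Module.finrank ℂ W = d + 1 →
      Module.finrank ℂ ↥(W ⊓ LinearMap.ker (σ - 1)) =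
        Module.finrank ℂ ↥(W ⊓ LinearMap.ker (σ + 1))) := by
  have pHE : ∀ x, H (E x) = E (H x) + (2 : ℂ) • E x := by
    intro x
    have := LinearMap.congr_fun hHE x
    simp only [Ring.lie_def, LinearMap.sub_apply, Module.End.mul_apply, LinearMap.smul_apply]
      at this
    rw [← this]; abel
  have pHF : ∀ x, H (F x) = F (H x) - (2 : ℂ) • F x := by
    intro x
    have := LinearMap.congr_fun hHF x
    simp only [Ring.lie_def, LinearMap.sub_apply, Module.End.mul_apply, LinearMap.smul_apply]
      at this
    rw [sub_eq_iff_eq_add.mp this]; module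
  have pEF : ∀ x, E (F x) = F (E x) + H x := by
    intro x
    have := LinearMap.congr_fun hEF x
    simp only [Ring.lie_def, LinearMap.sub_apply, Module.End.mul_apply] at this
    rw [← this]; abel
  have pσE : ∀ x, σ (E x) = -(E (σ x)) := fun x => LinearMap.congr_fun hσE x
  have pσF : ∀ x, σ (F x) = -(F (σ x)) := fun x => LinearMap.congr_fun hσF x
  have pσH : ∀ x, σ (H x) = H (σ x) := fun x => LinearMap.congr_fun hσH x
  have pσ2 : ∀ x, σ (σ x) = x := fun x => LinearMap.congr_fun hσ2 x
  refine ⟨?_, ?_, ?_⟩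
  · intro j
    have hst : ∀ x ∈ Module.End.eigenspace H ((2 * j : ℤ) : ℂ),
        σ x ∈ Module.End.eigenspace H ((2 * j : ℤ) : ℂ) := by
      intro x hx
      rw [Module.End.mem_eigenspace_iff] at hx ⊢
      rw [← pσH, hx, map_smul]
    apply le_antisymm
    · rintro _ ⟨x, hx, rfl⟩
      exact hst x hx
    · intro x hx
      exact ⟨σ x, hst x hx, pσ2 x⟩
  · intro j
    have h1 := Stmt15Aux.eq_all E H F σ pHE pHF pEF pσE pσF j 1
    have h2 := Stmt15Aux.eq_all E H F σ pHE pHF pEF pσE pσF j (-1)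
    rw [one_smul] at h1
    rw [neg_smul, one_smul, sub_neg_eq_add] at h2
    rw [h1, h2]
  · intro d hd W hW hirr hdim
    -- the rotated triple whose Cartan element is `E + F`
    have hinj : ∀ x ∈ W, (E + F) x = 0 → x = 0 := by
      intro x hx hx0
      refine Stmt15Aux.injH ((1 / 2 : ℂ) • (H - E + F)) (E + F) ((1 / 2 : ℂ) • (H + E - F))
        ?_ ?_ ?_ d hd W ?_ ?_ hdim x hx hx0
      · intro y
        simp only [LinearMap.add_apply, LinearMap.sub_apply, LinearMap.smul_apply, map_add,
          map_sub, map_smul, pHE, pHF, pEF]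
        module
      · intro y
        simp only [LinearMap.add_apply, LinearMap.sub_apply, LinearMap.smul_apply, map_add,
          map_sub, map_smul, pHE, pHF, pEF]
        module
      · intro y
        simp only [LinearMap.add_apply, LinearMap.sub_apply, LinearMap.smul_apply, map_add,
          map_sub, map_smul, pHE, pHF, pEF]
        module
      · intro y hy
        obtain ⟨h1, h2, h3, -⟩ := hW y hy
        exact ⟨W.smul_mem _ (W.add_mem (W.sub_mem h2 h1) h3), W.add_mem h1 h3,
          W.smul_mem _ (W.sub_mem (W.add_mem h2 h1) h3)⟩
      · intro U hUW hU
        refine hirr U hUW (fun y hy => ?_)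
        obtain ⟨h1, h2, h3⟩ := hU y hy
        have hH : H y ∈ U := by
          have := U.add_mem h1 h3
          have e : H y = ((1 / 2 : ℂ) • (H - E + F)) y + ((1 / 2 : ℂ) • (H + E - F)) y := by
            simp only [LinearMap.add_apply, LinearMap.sub_apply, LinearMap.smul_apply]
            module
          rw [e]; exact this
        have hD : E y - F y ∈ U := by
          have := U.sub_mem h3 h1
          have e : E y - F y
              = ((1 / 2 : ℂ) • (H + E - F)) y - ((1 / 2 : ℂ) • (H - E + F)) y := by
            simp only [LinearMap.add_apply, LinearMap.sub_apply, LinearMap.smul_apply]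
            module
          rw [e]; exact this
        have hS : E y + F y ∈ U := h2
        refine ⟨?_, hH, ?_⟩
        · have e : E y = (1 / 2 : ℂ) • ((E y + F y) + (E y - F y)) := by module
          rw [e]; exact U.smul_mem _ (U.add_mem hS hD)
        · have e : F y = (1 / 2 : ℂ) • ((E y + F y) - (E y - F y)) := by module
          rw [e]; exact U.smul_mem _ (U.sub_mem hS hD)
    apply le_antisymm
    · refine Stmt15Aux.le_of_inj _ _ (E + F) ?_ (fun x hx => hinj x hx.1)
      rintro x ⟨hx, hs⟩
      have hs' : σ x = x := by simpa [sub_eq_zero] using hs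
      refine ⟨W.add_mem (hW x hx).1 (hW x hx).2.2.1, ?_⟩
      change (σ + 1) ((E + F) x) = 0
      simp only [LinearMap.add_apply, map_add, pσE, pσF, hs',
        Module.End.one_apply]
      abel
    · refine Stmt15Aux.le_of_inj _ _ (E + F) ?_ (fun x hx => hinj x hx.1)
      rintro x ⟨hx, hs⟩
      have hs' : σ x = -x := by simpa [add_eq_zero_iff_eq_neg] using hs
      refine ⟨W.add_mem (hW x hx).1 (hW x hx).2.2.1, ?_⟩
      change (σ - 1) ((E + F) x) = 0
      simp only [LinearMap.add_apply, LinearMap.sub_apply, map_add, pσE, pσF,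
        hs', Module.End.one_apply, map_neg]
      abel
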